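/- arXiv:1912.03824 — 3 statements merged into one kernel-verified Lean document; each statement's English description precedes it below -/
import Mathlib

section
/- For all positive integers l and p, the quotient (l + p − 1)!/p! is at most e·(p/e)^l·((p+l)/p)^{p+l}, where e is Euler's number. -/
theorem exp_one_mul_pow_succ_le (n : ℕ) :
    Real.exp 1 * (n : ℝ) ^ (n + 1) ≤ ((n : ℝ) + 1) ^ (n + 1) := by
  have hn : (0 : ℝ) < (n : ℝ) + 1 := by positivity
  have h := Real.one_sub_div_pow_le_exp_neg (n := n + 1) (t := 1) (by simp)
  have hdiv : 1 - 1 / ((n + 1 : ℕ) : ℝ) = (n : ℝ) / ((n : ℝ) + 1) := by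
    push_cast
    field_simp
    ring
  rw [hdiv, div_pow, div_le_iff₀ (by positivity)] at h
  calc Real.exp 1 * (n : ℝ) ^ (n + 1)
      ≤ Real.exp 1 * (Real.exp (-1) * ((n : ℝ) + 1) ^ (n + 1)) := by gcongr
    _ = ((n : ℝ) + 1) ^ (n + 1) := by
      rw [← mul_assoc, ← Real.exp_add]
      simp

theorem factorial_add_mul_exp_one_pow_le (k p : ℕ) :
    ((k + p).factorial : ℝ) * Real.exp 1 ^ k * (p : ℝ) ^ p ≤
      p.factorial * ((p : ℝ) + k + 1) ^ (p + k + 1) := by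
  induction k with
  | zero =>
    have h : (p : ℝ) ^ p ≤ ((p : ℝ) + 1) ^ (p + 1) :=
      calc (p : ℝ) ^ p ≤ ((p : ℝ) + 1) ^ p := by gcongr; linarith
        _ ≤ ((p : ℝ) + 1) ^ (p + 1) := pow_le_pow_right₀ (by simp) (Nat.le_succ p)
    simpa using mul_le_mul_of_nonneg_left h (Nat.cast_nonneg p.factorial)
  | succ k ih =>
    have h := exp_one_mul_pow_succ_le (p + k + 1)
    push_cast at h ⊢
    rw [show k + 1 + p = (k + p) + 1 by ring, Nat.factorial_succ]
    push_cast
    calc ((k : ℝ) + p + 1) * (k + p).factorial * Real.exp 1 ^ (k + 1) * (p : ℝ) ^ p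
        = ((k : ℝ) + p + 1) * Real.exp 1 *
            ((k + p).factorial * Real.exp 1 ^ k * (p : ℝ) ^ p) := by ring
      _ ≤ ((k : ℝ) + p + 1) * Real.exp 1 *
            (p.factorial * ((p : ℝ) + k + 1) ^ (p + k + 1)) := by gcongr
      _ = p.factorial * (Real.exp 1 * ((p : ℝ) + k + 1) ^ (p + k + 1 + 1)) := by ring
      _ ≤ p.factorial * ((p : ℝ) + k + 1 + 1) ^ (p + k + 1 + 1) := by gcongr
      _ = p.factorial * ((p : ℝ) + (k + 1) + 1) ^ (p + (k + 1) + 1) := by ring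

/-- For positive integers `l` and `p`: `(l + p - 1)!/p! ≤ e·(p/e)^l·((p+l)/p)^(p+l)`. -/
theorem factorial_ratio_bound (l p : ℕ) (hl : 0 < l) (hp : 0 < p) :
    ((l + p - 1).factorial : ℝ) / (p.factorial : ℝ) ≤
      Real.exp 1 * ((p : ℝ) / Real.exp 1) ^ l * (((p : ℝ) + (l : ℝ)) / (p : ℝ)) ^ (p + l) := by
  obtain ⟨k, rfl⟩ := Nat.exists_eq_add_of_lt hl
  have h := factorial_add_mul_exp_one_pow_le k p
  have hp' : (0 : ℝ) < p := by exact_mod_cast hp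
  have he := Real.exp_pos 1
  have hrhs : Real.exp 1 * ((p : ℝ) / Real.exp 1) ^ (k + 1) *
      (((p : ℝ) + k + 1) / p) ^ (p + k + 1) =
      ((p : ℝ) + k + 1) ^ (p + k + 1) / (Real.exp 1 ^ k * (p : ℝ) ^ p) := by
    rw [div_pow, div_pow, show p + k + 1 = p + (k + 1) by ring, pow_add (p : ℝ) p (k + 1),
      pow_succ (Real.exp 1) k]
    field_simp
  rw [show 0 + k + 1 + p - 1 = k + p by omega, zero_add]
  push_cast
  rw [← add_assoc, ← add_assoc, hrhs, div_le_div_iff₀ (by positivity) (by positivity)]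
  linarith
end

section
/- Let β > 1 be a real number, let l be a positive integer, and let m be a positive integer with m > l/log(β). Then β^{−1}·e^{l/m} < 1 and the series ∑_{k=m}^∞ β^{−k}·k^l converges, with ∑_{k=m}^∞ β^{−k}·k^l ≤ m^l·β^{−m}·1/(1 − β^{−1}·e^{l/m}). -/
/-- From `1 + x ≤ exp x`: the power `(m + k) ^ l` grows at most geometrically in `k`. -/
theorem add_pow_le_pow_mul_exp_pow (l k : ℕ) {m : ℕ} (hm : 0 < m) :
    ((m + k : ℕ) : ℝ) ^ l ≤ (m : ℝ) ^ l * Real.exp ((l : ℝ) / (m : ℝ)) ^ k := by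
  have hm' : (0 : ℝ) < m := by exact_mod_cast hm
  calc ((m + k : ℕ) : ℝ) ^ l = (m * ((k : ℝ) / m + 1)) ^ l := by
        push_cast
        field_simp
        ring
    _ ≤ (m * Real.exp ((k : ℝ) / m)) ^ l := by
        gcongr
        exact Real.add_one_le_exp _
    _ = (m : ℝ) ^ l * Real.exp ((l : ℝ) / (m : ℝ)) ^ k := by
        rw [mul_pow, ← Real.exp_nat_mul, ← Real.exp_nat_mul]
        ring_nf

/-- Tail estimate: for `β > 1`, `l ≥ 1` and `m > l/log β`, we have
`β⁻¹·e^(l/m) < 1`, the series `∑_{k≥m} β⁻ᵏ·kˡ` converges, and its sum is at most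
`mˡ·β⁻ᵐ·1/(1 - β⁻¹·e^(l/m))`. -/
theorem geometric_polynomial_tail_bound (β : ℝ) (hβ : 1 < β) (l m : ℕ)
    (hl : 0 < l) (hm : 0 < m) (hml : (l : ℝ) / Real.log β < (m : ℝ)) :
    β⁻¹ * Real.exp ((l : ℝ) / (m : ℝ)) < 1 ∧
    Summable (fun k : ℕ => ((m + k : ℕ) : ℝ) ^ l / β ^ (m + k)) ∧
    ∑' k : ℕ, ((m + k : ℕ) : ℝ) ^ l / β ^ (m + k) ≤
      (m : ℝ) ^ l * (β ^ m)⁻¹ * (1 - β⁻¹ * Real.exp ((l : ℝ) / (m : ℝ)))⁻¹ := by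
  have hβ0 : 0 < β := by linarith
  have hm' : (0 : ℝ) < m := by exact_mod_cast hm
  have hlog : (l : ℝ) / m < Real.log β := (div_lt_comm₀ (Real.log_pos hβ) hm').1 hml
  set r := β⁻¹ * Real.exp ((l : ℝ) / (m : ℝ)) with hr
  have hr1 : r < 1 := by
    rw [hr, inv_mul_lt_iff₀ hβ0, mul_one]
    exact (Real.lt_log_iff_exp_lt hβ0).1 hlog
  have hr0 : 0 ≤ r := by positivity
  have hle (k : ℕ) :
      ((m + k : ℕ) : ℝ) ^ l / β ^ (m + k) ≤ (m : ℝ) ^ l * (β ^ m)⁻¹ * r ^ k := by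
    calc ((m + k : ℕ) : ℝ) ^ l / β ^ (m + k)
        ≤ (m : ℝ) ^ l * Real.exp ((l : ℝ) / (m : ℝ)) ^ k / β ^ (m + k) := by
          gcongr
          exact add_pow_le_pow_mul_exp_pow l k hm
      _ = (m : ℝ) ^ l * (β ^ m)⁻¹ * r ^ k := by
          rw [hr, mul_pow, inv_pow, pow_add]
          field_simp
  have hgeom := (hasSum_geometric_of_lt_one hr0 hr1).mul_left ((m : ℝ) ^ l * (β ^ m)⁻¹)
  have hsum : Summable (fun k : ℕ => ((m + k : ℕ) : ℝ) ^ l / β ^ (m + k)) :=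
    hgeom.summable.of_nonneg_of_le (fun k => by positivity) hle
  exact ⟨hr1, hsum, hasSum_le hle hsum.hasSum hgeom⟩
end

section
/- Let 0 < ε ≤ 1, let n ≥ 1, and let A be an n×n Hermitian positive definite complex matrix with A ⪯ I. For 1 ≤ i ≤ n let u_i = e_i† (A^{(i)})^{−1} e_i, where A^{(i)} is the i×i leading principal submatrix of A and e_i is the i-th standard basis vector of ℂ^i. Suppose v_1, …, v_n are real numbers with |v_i − u_i| ≤ ε/(2n) for every i. Then each v_i > 0 and |∏_{i=1}^n v_i^{−1} − det(A)| ≤ 2ε·det(A); that is, ∏_{i=1}^n v_i^{−1} is a multiplicative approximation of det(A) with relative error at most 2ε. -/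
open Matrix
open scoped ComplexOrder

/-- The leading principal submatrix of `A` consisting of its first `i+1` rows and columns. -/
def leadingSubmatrix {n : ℕ} (A : Matrix (Fin n) (Fin n) ℂ) (i : Fin n) :
    Matrix (Fin (i.val + 1)) (Fin (i.val + 1)) ℂ :=
  A.submatrix (Fin.castLE i.isLt) (Fin.castLE i.isLt)

theorem Matrix.PosDef.posSemidef_inv_sub_one {m : Type*} [Fintype m] [DecidableEq m]
    {B : Matrix m m ℂ} (hB : B.PosDef) (hBI : (1 - B).PosSemidef) : (B⁻¹ - 1).PosSemidef := by
  have hu : IsUnit B.det := (Matrix.isUnit_iff_isUnit_det B).1 hB.isUnit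
  have h := hB.posSemidef.mul_mul_conjTranspose_same (1 - B⁻¹)
  have hH : (1 - B⁻¹)ᴴ = 1 - B⁻¹ := by
    rw [conjTranspose_sub, conjTranspose_one, hB.isHermitian.inv.eq]
  have e : B⁻¹ - 1 = (1 - B⁻¹) * B * (1 - B⁻¹)ᴴ + (1 - B) := by
    rw [hH, sub_mul, nonsing_inv_mul _ hu, one_mul, mul_sub, sub_mul, sub_mul, mul_nonsing_inv _ hu]
    simp only [mul_one, one_mul]
    abel
  rw [e]
  exact h.add hBI

theorem Matrix.inv_last_last {k : ℕ} {K : Type*} [Field K]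
    (B : Matrix (Fin (k + 1)) (Fin (k + 1)) K) :
    B⁻¹ (Fin.last k) (Fin.last k) = (B.submatrix Fin.castSucc Fin.castSucc).det / B.det := by
  rw [inv_def, smul_apply, adjugate_fin_succ_eq_det_submatrix, Ring.inverse_eq_inv', smul_eq_mul,
    div_eq_inv_mul, ← two_mul, pow_mul]
  simp [Fin.succAbove_last]

theorem leadingSubmatrix_posDef {n : ℕ} {A : Matrix (Fin n) (Fin n) ℂ} (hA : A.PosDef)
    (i : Fin n) : (leadingSubmatrix A i).PosDef :=
  hA.submatrix (Fin.castLE_injective i.isLt)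

theorem one_sub_leadingSubmatrix_posSemidef {n : ℕ} {A : Matrix (Fin n) (Fin n) ℂ}
    (hA : (1 - A).PosSemidef) (i : Fin n) : (1 - leadingSubmatrix A i).PosSemidef := by
  have h := hA.submatrix (Fin.castLE i.isLt)
  rwa [submatrix_sub, Pi.sub_apply, Pi.sub_apply,
    submatrix_one _ (Fin.castLE_injective i.isLt)] at h

theorem det_eq_prod_inv_leadingSubmatrix {n : ℕ} {A : Matrix (Fin n) (Fin n) ℂ}
    (hA : A.PosDef) :
    A.det = ∏ i : Fin n, ((leadingSubmatrix A i)⁻¹ (Fin.last i.val) (Fin.last i.val))⁻¹ := by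
  induction n with
  | zero => simp
  | succ k ih =>
    have hS : (A.submatrix Fin.castSucc Fin.castSucc).PosDef :=
      hA.submatrix (Fin.castSucc_injective k)
    have hlast : leadingSubmatrix A (Fin.last k) = A := rfl
    have h0 := hS.det_pos.ne'
    rw [Fin.prod_univ_castSucc]
    have hprod : ∏ i : Fin k, ((leadingSubmatrix A i.castSucc)⁻¹
        (Fin.last i.castSucc.val) (Fin.last i.castSucc.val))⁻¹ =
        (A.submatrix Fin.castSucc Fin.castSucc).det := (ih hS).symm
    have hl : ((leadingSubmatrix A (Fin.last k))⁻¹ (Fin.last (Fin.last k).val)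
        (Fin.last (Fin.last k).val)) = (A.submatrix Fin.castSucc Fin.castSucc).det / A.det :=
      Matrix.inv_last_last A
    rw [hprod, hl, inv_div, mul_div_cancel₀ _ h0]

theorem one_le_inv_leadingSubmatrix {n : ℕ} {A : Matrix (Fin n) (Fin n) ℂ} (hA : A.PosDef)
    (hAI : (1 - A).PosSemidef) (i : Fin n) :
    1 ≤ (leadingSubmatrix A i)⁻¹ (Fin.last i.val) (Fin.last i.val) := by
  have h := ((leadingSubmatrix_posDef hA i).posSemidef_inv_sub_one
    (one_sub_leadingSubmatrix_posSemidef hAI i)).diag_nonneg (i := Fin.last i.val)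
  rwa [Matrix.sub_apply, one_apply_eq, sub_nonneg] at h

theorem inv_mem_Icc_of_abs_sub_le {u v δ : ℝ} (hu : 1 ≤ u) (hδ : δ < 1)
    (h : |v - u| ≤ δ) : 0 < v ∧ (1 - δ) * u⁻¹ ≤ v⁻¹ ∧ (1 - δ) * v⁻¹ ≤ u⁻¹ := by
  obtain ⟨h1, h2⟩ := abs_le.1 h
  have hδ0 : 0 ≤ δ := (abs_nonneg _).trans h
  have hv : 0 < v := by linarith
  have hu0 : 0 < u := by linarith
  refine ⟨hv, ?_, ?_⟩
  · rw [← div_eq_mul_inv, ← one_div, div_le_div_iff₀ hu0 hv]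
    nlinarith
  · rw [← div_eq_mul_inv, ← one_div, div_le_div_iff₀ hv hu0]
    nlinarith

theorem abs_prod_inv_sub_prod_inv_le {n : ℕ} (hn : 1 ≤ n) {ε : ℝ} (hε0 : 0 < ε) (hε1 : ε ≤ 1)
    {u v : Fin n → ℝ} (hu : ∀ i, 1 ≤ u i) (h : ∀ i, |v i - u i| ≤ ε / (2 * n)) :
    (∀ i, 0 < v i) ∧ |∏ i, (v i)⁻¹ - ∏ i, (u i)⁻¹| ≤ 2 * ε * ∏ i, (u i)⁻¹ := by
  have hn' : (1 : ℝ) ≤ n := by exact_mod_cast hn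
  have hnδ : n * (ε / (2 * n)) = ε / 2 := by field_simp
  set δ := ε / (2 * n) with hδ
  have hδ0 : 0 < δ := by positivity
  have hδ1 : δ < 1 := by nlinarith
  have key := fun i => inv_mem_Icc_of_abs_sub_le (hu i) hδ1 (h i)
  have hu0 : ∀ i, 0 < u i := fun i => one_pos.trans_le (hu i)
  have hU : 0 < ∏ i, (u i)⁻¹ := Finset.prod_pos fun i _ => inv_pos.2 (hu0 i)
  have hV : 0 < ∏ i, (v i)⁻¹ := Finset.prod_pos fun i _ => inv_pos.2 (key i).1
  have bern : 1 - ε / 2 ≤ (1 - δ) ^ n := by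
    have := one_add_mul_le_pow (a := -δ) (by linarith) n
    rw [← sub_eq_add_neg] at this
    linarith
  have lower : (1 - δ) ^ n * ∏ i, (u i)⁻¹ ≤ ∏ i, (v i)⁻¹ := by
    have := Finset.prod_le_prod (s := Finset.univ)
      (fun i _ => mul_nonneg (sub_nonneg.2 hδ1.le) (inv_pos.2 (hu0 i)).le)
      (fun i _ => (key i).2.1)
    simpa [Finset.prod_mul_distrib] using this
  have upper : (1 - δ) ^ n * ∏ i, (v i)⁻¹ ≤ ∏ i, (u i)⁻¹ := by
    have := Finset.prod_le_prod (s := Finset.univ)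
      (fun i _ => mul_nonneg (sub_nonneg.2 hδ1.le) (inv_pos.2 (key i).1).le)
      (fun i _ => (key i).2.2)
    simpa [Finset.prod_mul_distrib] using this
  refine ⟨fun i => (key i).1, ?_⟩
  generalize ∏ i, (u i)⁻¹ = U at *
  generalize ∏ i, (v i)⁻¹ = V at *
  have lower' := (mul_le_mul_of_nonneg_right bern hU.le).trans lower
  have upper' := (mul_le_mul_of_nonneg_right bern hV.le).trans upper
  have hVU : V ≤ 2 * U := by nlinarith
  rw [abs_le]
  constructor <;> nlinarith [mul_pos hε0 hU, mul_le_mul_of_nonneg_left hVU hε0.le]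

/-- Let `0 < ε ≤ 1`, `n ≥ 1`, and `A` Hermitian positive definite with `A ⪯ I`. If the real
numbers `v i` approximate `uᵢ = eᵢ† (A⁽ⁱ⁾)⁻¹ eᵢ` to within `ε/(2n)`, then each `v i > 0`
and `∏ᵢ (v i)⁻¹` approximates `det A` with relative error at most `2ε`. -/
theorem det_multiplicative_approximation (n : ℕ) (hn : 1 ≤ n) (ε : ℝ)
    (hε0 : 0 < ε) (hε1 : ε ≤ 1) (A : Matrix (Fin n) (Fin n) ℂ)
    (hA : A.PosDef) (hAI : ((1 : Matrix (Fin n) (Fin n) ℂ) - A).PosSemidef)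
    (v : Fin n → ℝ)
    (hv : ∀ i : Fin n,
      |v i - (((leadingSubmatrix A i)⁻¹) (Fin.last i.val) (Fin.last i.val)).re|
        ≤ ε / (2 * n)) :
    (∀ i, 0 < v i) ∧
    |(∏ i : Fin n, (v i)⁻¹) - A.det.re| ≤ 2 * ε * A.det.re := by
  have h1 := one_le_inv_leadingSubmatrix hA hAI
  have hdet : A.det.re = ∏ i : Fin n,
      (((leadingSubmatrix A i)⁻¹ (Fin.last i.val) (Fin.last i.val)).re)⁻¹ := by
    rw [← Complex.ofReal_re (∏ i : Fin n, _), det_eq_prod_inv_leadingSubmatrix hA]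
    congr 1
    push_cast
    refine Finset.prod_congr rfl fun i _ => ?_
    congr 1
    exact Complex.ext rfl (Complex.le_def.1 (h1 i)).2.symm
  rw [hdet]
  exact abs_prod_inv_sub_prod_inv_le hn hε0 hε1 (fun i => (Complex.le_def.1 (h1 i)).1) hv
end
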